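/- Assume sin²(α)·κ₂ ≠ κ₁. Then the evolutoid E₁ is regular (an immersion) at (0,0), i.e. ∂_u E₁(0,0) × ∂_v E₁(0,0) ≠ 0, if and only if a₀₃ ≠ 0 (i.e. if and only if the origin is not a ridge point of S with respect to the principal direction ∂_v). -/

import Mathlib

noncomputable section

open Real

def dot3 (a b : Fin 3 → ℝ) : ℝ := a 0 * b 0 + a 1 * b 1 + a 2 * b 2

def cross3 (a b : Fin 3 → ℝ) : Fin 3 → ℝ :=
  ![a 1 * b 2 - a 2 * b 1, a 2 * b 0 - a 0 * b 2, a 0 * b 1 - a 1 * b 0]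

def norm3 (a : Fin 3 → ℝ) : ℝ := Real.sqrt (dot3 a a)

noncomputable def pdu {X : Type*} [NormedAddCommGroup X] [NormedSpace ℝ X]
    (f : ℝ × ℝ → X) : ℝ × ℝ → X := fun p => deriv (fun t => f (t, p.2)) p.1

noncomputable def pdv {X : Type*} [NormedAddCommGroup X] [NormedSpace ℝ X]
    (f : ℝ × ℝ → X) : ℝ × ℝ → X := fun p => deriv (fun t => f (p.1, t)) p.2

noncomputable def pd (i j : ℕ) (f : ℝ × ℝ → ℝ) : ℝ × ℝ → ℝ :=
  (pdu (X := ℝ))^[i] ((pdv (X := ℝ))^[j] f)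

def mongeSurf (f : ℝ × ℝ → ℝ) : ℝ × ℝ → Fin 3 → ℝ := fun p => ![p.1, p.2, f p]

noncomputable def unitNormal (ψ : ℝ × ℝ → Fin 3 → ℝ) : ℝ × ℝ → Fin 3 → ℝ := fun p =>
  (norm3 (cross3 (pdu ψ p) (pdv ψ p)))⁻¹ • cross3 (pdu ψ p) (pdv ψ p)

noncomputable def coefE (f : ℝ × ℝ → ℝ) : ℝ × ℝ → ℝ := fun p => 1 + (pdu f p) ^ 2
noncomputable def coefG (f : ℝ × ℝ → ℝ) : ℝ × ℝ → ℝ := fun p => 1 + (pdv f p) ^ 2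

noncomputable def kap2 (f : ℝ × ℝ → ℝ) : ℝ × ℝ → ℝ := fun p =>
  dot3 (pdv (pdv (mongeSurf f)) p) (unitNormal (mongeSurf f) p) / coefG f p

noncomputable def rfun (α : ℝ) (f : ℝ × ℝ → ℝ) : ℝ × ℝ → ℝ := fun p =>
  -(2 * Real.sqrt (coefE f p) * coefG f p) /
    (Real.cos α * pdu (coefG f) p -
      2 * Real.sin α * Real.sqrt (coefE f p) * coefG f p * kap2 f p)

noncomputable def evolutoid (α : ℝ) (f : ℝ × ℝ → ℝ) : ℝ × ℝ → Fin 3 → ℝ := fun p =>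
  mongeSurf f p +
    rfun α f p •
      ((Real.cos α / Real.sqrt (coefE f p)) • pdu (mongeSurf f) p +
        Real.sin α • unitNormal (mongeSurf f) p)

def MongeHyp (κ₁ κ₂ : ℝ) (a : ℕ → ℕ → ℝ) (f : ℝ × ℝ → ℝ) : Prop :=
  ContDiff ℝ (⊤ : ℕ∞) f ∧ f (0, 0) = 0 ∧
    pdu f (0, 0) = 0 ∧ pdv f (0, 0) = 0 ∧
    pd 2 0 f (0, 0) = κ₁ ∧ pd 1 1 f (0, 0) = 0 ∧ pd 0 2 f (0, 0) = κ₂ ∧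
    ∀ i j : ℕ, 3 ≤ i + j → i + j ≤ 4 → pd i j f (0, 0) = a i j

noncomputable def gaussK (ψ : ℝ × ℝ → Fin 3 → ℝ) : ℝ × ℝ → ℝ := fun p =>
  (dot3 (pdu (pdu ψ) p) (unitNormal ψ p) * dot3 (pdv (pdv ψ) p) (unitNormal ψ p) -
      dot3 (pdu (pdv ψ) p) (unitNormal ψ p) ^ 2) /
    (norm3 (pdu ψ p) ^ 2 * norm3 (pdv ψ p) ^ 2 - (dot3 (pdu ψ p) (pdv ψ p)) ^ 2)

def AEquivalentAt {E F : Type*} [NormedAddCommGroup E] [NormedSpace ℝ E]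
    [NormedAddCommGroup F] [NormedSpace ℝ F]
    (f : E → F) (p : E) (g : E → F) (q : E) : Prop :=
  ∃ (h : PartialHomeomorph E E) (ξ : PartialHomeomorph F F),
    p ∈ h.source ∧ h p = q ∧
    ContDiffOn ℝ (⊤ : ℕ∞) h h.source ∧ ContDiffOn ℝ (⊤ : ℕ∞) h.symm h.target ∧
    f p ∈ ξ.source ∧ ξ (f p) = g q ∧
    ContDiffOn ℝ (⊤ : ℕ∞) ξ ξ.source ∧ ContDiffOn ℝ (⊤ : ℕ∞) ξ.symm ξ.target ∧
    ∀ᶠ x in nhds p, ξ (f x) = g (h x)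

theorem hasDerivAt_comp_prodMk_left {X : Type*} [NormedAddCommGroup X] [NormedSpace ℝ X]
    {g : ℝ × ℝ → X} {p : ℝ × ℝ} (hg : DifferentiableAt ℝ g p) :
    HasDerivAt (fun t => g (t, p.2)) (fderiv ℝ g p (1, 0)) p.1 :=
  HasFDerivAt.comp_hasDerivAt (f := fun t : ℝ => (t, p.2)) p.1 hg.hasFDerivAt
    ((hasDerivAt_id p.1).prodMk (hasDerivAt_const p.1 p.2))

theorem hasDerivAt_comp_prodMk_right {X : Type*} [NormedAddCommGroup X] [NormedSpace ℝ X]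
    {g : ℝ × ℝ → X} {p : ℝ × ℝ} (hg : DifferentiableAt ℝ g p) :
    HasDerivAt (fun t => g (p.1, t)) (fderiv ℝ g p (0, 1)) p.2 :=
  HasFDerivAt.comp_hasDerivAt (f := fun t : ℝ => (p.1, t)) p.2 hg.hasFDerivAt
    ((hasDerivAt_const p.2 p.1).prodMk (hasDerivAt_id p.2))

theorem pdu_eq_fderiv {X : Type*} [NormedAddCommGroup X] [NormedSpace ℝ X]
    {g : ℝ × ℝ → X} (hg : Differentiable ℝ g) : pdu g = fun p => fderiv ℝ g p (1, 0) :=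
  funext fun p => (hasDerivAt_comp_prodMk_left (hg p)).deriv

theorem pdv_eq_fderiv {X : Type*} [NormedAddCommGroup X] [NormedSpace ℝ X]
    {g : ℝ × ℝ → X} (hg : Differentiable ℝ g) : pdv g = fun p => fderiv ℝ g p (0, 1) :=
  funext fun p => (hasDerivAt_comp_prodMk_right (hg p)).deriv

theorem hasDerivAt_pdu {X : Type*} [NormedAddCommGroup X] [NormedSpace ℝ X]
    {g : ℝ × ℝ → X} (hg : Differentiable ℝ g) (p : ℝ × ℝ) :
    HasDerivAt (fun t => g (t, p.2)) (pdu g p) p.1 :=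
  (hasDerivAt_comp_prodMk_left (hg p)).differentiableAt.hasDerivAt

theorem hasDerivAt_pdv {X : Type*} [NormedAddCommGroup X] [NormedSpace ℝ X]
    {g : ℝ × ℝ → X} (hg : Differentiable ℝ g) (p : ℝ × ℝ) :
    HasDerivAt (fun t => g (p.1, t)) (pdv g p) p.2 :=
  (hasDerivAt_comp_prodMk_right (hg p)).differentiableAt.hasDerivAt

theorem contDiff_pdu {X : Type*} [NormedAddCommGroup X] [NormedSpace ℝ X]
    {g : ℝ × ℝ → X} (hg : ContDiff ℝ (⊤ : ℕ∞) g) : ContDiff ℝ (⊤ : ℕ∞) (pdu g) := by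
  rw [pdu_eq_fderiv (hg.differentiable (by simp))]
  exact (hg.fderiv_right (by simp)).clm_apply contDiff_const

theorem contDiff_pdv {X : Type*} [NormedAddCommGroup X] [NormedSpace ℝ X]
    {g : ℝ × ℝ → X} (hg : ContDiff ℝ (⊤ : ℕ∞) g) : ContDiff ℝ (⊤ : ℕ∞) (pdv g) := by
  rw [pdv_eq_fderiv (hg.differentiable (by simp))]
  exact (hg.fderiv_right (by simp)).clm_apply contDiff_const

/-- Symmetry of mixed partial derivatives. -/
theorem pdv_pdu_comm {X : Type*} [NormedAddCommGroup X] [NormedSpace ℝ X]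
    {g : ℝ × ℝ → X} (hg : ContDiff ℝ (⊤ : ℕ∞) g) : pdv (pdu g) = pdu (pdv g) := by
  have hd := hg.differentiable (by simp)
  have hf : Differentiable ℝ (fderiv ℝ g) :=
    (hg.fderiv_right (m := (⊤ : ℕ∞)) (by simp)).differentiable (by simp)
  rw [pdv_eq_fderiv ((contDiff_pdu hg).differentiable (by simp)),
    pdu_eq_fderiv ((contDiff_pdv hg).differentiable (by simp)), pdu_eq_fderiv hd,
    pdv_eq_fderiv hd]
  funext p
  have hs : IsSymmSndFDerivAt ℝ g p := hg.contDiffAt.isSymmSndFDerivAt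
    (by simpa using WithTop.coe_le_coe.mpr (le_top (a := (2 : ℕ∞))))
  rw [fderiv_clm_apply (hf p) (differentiableAt_const _),
    fderiv_clm_apply (hf p) (differentiableAt_const _)]
  simpa using hs.eq (0, 1) (1, 0)

theorem hasDerivAt_vec3 {x y z : ℝ → ℝ} {x' y' z' t : ℝ} (hx : HasDerivAt x x' t)
    (hy : HasDerivAt y y' t) (hz : HasDerivAt z z' t) :
    HasDerivAt (fun s => ![x s, y s, z s]) ![x', y', z'] t := by
  rw [hasDerivAt_pi]
  intro i
  fin_cases i <;> simpa

theorem pdu_mongeSurf {f : ℝ × ℝ → ℝ} (hf : Differentiable ℝ f) (p : ℝ × ℝ) :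
    pdu (mongeSurf f) p = ![1, 0, pdu f p] :=
  (hasDerivAt_vec3 (hasDerivAt_id p.1) (hasDerivAt_const p.1 p.2) (hasDerivAt_pdu hf p)).deriv

theorem pdv_mongeSurf {f : ℝ × ℝ → ℝ} (hf : Differentiable ℝ f) (p : ℝ × ℝ) :
    pdv (mongeSurf f) p = ![0, 1, pdv f p] :=
  (hasDerivAt_vec3 (hasDerivAt_const p.2 p.1) (hasDerivAt_id p.2) (hasDerivAt_pdv hf p)).deriv

theorem pdv_pdv_mongeSurf {f : ℝ × ℝ → ℝ} (hf : ContDiff ℝ (⊤ : ℕ∞) f) (p : ℝ × ℝ) :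
    pdv (pdv (mongeSurf f)) p = ![0, 0, pdv (pdv f) p] := by
  rw [show pdv (mongeSurf f) = fun p => ![0, 1, pdv f p] from
    funext (pdv_mongeSurf (hf.differentiable (by simp)))]
  exact (hasDerivAt_vec3 (hasDerivAt_const p.2 _) (hasDerivAt_const p.2 _)
    (hasDerivAt_pdv ((contDiff_pdv hf).differentiable (by simp)) p)).deriv

theorem unitNormal_mongeSurf {f : ℝ × ℝ → ℝ} (hf : Differentiable ℝ f) (p : ℝ × ℝ) :
    unitNormal (mongeSurf f) p =
      (√(1 + pdu f p ^ 2 + pdv f p ^ 2))⁻¹ • ![-pdu f p, -pdv f p, 1] := by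
  have hc : cross3 ![1, 0, pdu f p] ![0, 1, pdv f p] = ![-pdu f p, -pdv f p, 1] := by
    simp [cross3]
  rw [unitNormal, pdu_mongeSurf hf, pdv_mongeSurf hf, hc, norm3]
  congr 3
  simp [dot3]
  ring

theorem pdu_coefG {f : ℝ × ℝ → ℝ} (hf : ContDiff ℝ (⊤ : ℕ∞) f) (p : ℝ × ℝ) :
    pdu (coefG f) p = 2 * pdv f p * pdu (pdv f) p := by
  have h := ((hasDerivAt_pdu ((contDiff_pdv hf).differentiable (by simp)) p).pow 2).const_add 1
  refine h.deriv.trans ?_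
  simp

/-- The radius function of the evolutoid in terms of `P = f_u`, `Q = f_v`, `w = f_vv`,
`m = f_uv`. -/
def monRadius (α P Q w m : ℝ) : ℝ :=
  -(2 * √(1 + P ^ 2) * (1 + Q ^ 2)) /
    (cos α * (2 * Q * m) -
      2 * sin α * √(1 + P ^ 2) * (1 + Q ^ 2) *
        (w * (√(1 + P ^ 2 + Q ^ 2))⁻¹ / (1 + Q ^ 2)))

theorem rfun_eq_monRadius (α : ℝ) {f : ℝ × ℝ → ℝ} (hf : ContDiff ℝ (⊤ : ℕ∞) f) (p : ℝ × ℝ) :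
    rfun α f p = monRadius α (pdu f p) (pdv f p) (pdv (pdv f) p) (pdu (pdv f) p) := by
  rw [rfun, kap2, pdu_coefG hf, pdv_pdv_mongeSurf hf,
    unitNormal_mongeSurf (hf.differentiable (by simp))]
  simp [monRadius, dot3, coefE, coefG]

theorem evolutoid_eq (α : ℝ) {f : ℝ × ℝ → ℝ} (hf : ContDiff ℝ (⊤ : ℕ∞) f) (p : ℝ × ℝ) :
    evolutoid α f p =
      ![p.1 + rfun α f p * (cos α / √(1 + pdu f p ^ 2) +
          sin α * ((√(1 + pdu f p ^ 2 + pdv f p ^ 2))⁻¹ * -pdu f p)),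
        p.2 + rfun α f p * (sin α * ((√(1 + pdu f p ^ 2 + pdv f p ^ 2))⁻¹ * -pdv f p)),
        f p + rfun α f p * (cos α / √(1 + pdu f p ^ 2) * pdu f p +
          sin α * (√(1 + pdu f p ^ 2 + pdv f p ^ 2))⁻¹)] := by
  have hd := hf.differentiable (by simp)
  rw [evolutoid, unitNormal_mongeSurf hd, pdu_mongeSurf hd]
  ext i
  fin_cases i <;> simp [mongeSurf, coefE]

section Curve

variable {α κ P' Q' w' m' : ℝ} {P Q w m : ℝ → ℝ}

theorem hasDerivAt_sqrt_one_add_sq (hP : HasDerivAt P P' 0) (hP0 : P 0 = 0) :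
    HasDerivAt (fun t => √(1 + P t ^ 2)) 0 0 := by
  have h := ((hP.pow 2).const_add 1).sqrt (by simp [hP0])
  simpa [hP0] using h

theorem hasDerivAt_inv_sqrt_one_add_sq_add_sq (hP : HasDerivAt P P' 0) (hP0 : P 0 = 0)
    (hQ : HasDerivAt Q Q' 0) (hQ0 : Q 0 = 0) :
    HasDerivAt (fun t => (√(1 + P t ^ 2 + Q t ^ 2))⁻¹) 0 0 := by
  have h := ((((hP.pow 2).const_add 1).add (hQ.pow 2)).sqrt (by simp [hP0, hQ0])).inv
    (by simp [hP0, hQ0])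
  exact h.congr_deriv (by simp [hP0, hQ0])

theorem hasDerivAt_monRadius (hP : HasDerivAt P P' 0) (hP0 : P 0 = 0)
    (hQ : HasDerivAt Q Q' 0) (hQ0 : Q 0 = 0) (hw : HasDerivAt w w' 0) (hw0 : w 0 = κ)
    (hm : HasDerivAt m m' 0) (hm0 : m 0 = 0) (hα : sin α ≠ 0) (hκ : κ ≠ 0) :
    HasDerivAt (fun t => monRadius α (P t) (Q t) (w t) (m t)) (-w' / (sin α * κ ^ 2)) 0 := by
  have hE := hasDerivAt_sqrt_one_add_sq hP hP0
  have hW := hasDerivAt_inv_sqrt_one_add_sq_add_sq hP hP0 hQ hQ0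
  have hG : HasDerivAt (fun t => 1 + Q t ^ 2) 0 0 := by
    simpa [hQ0] using (hQ.pow 2).const_add 1
  have hnum := ((hE.const_mul 2).mul hG).neg
  have hden := (((hQ.const_mul 2).mul hm).const_mul (cos α)).sub
    (((hE.const_mul (2 * sin α)).mul hG).mul ((hw.mul hW).div hG (by simp [hQ0])))
  have h := hnum.div hden (by simp [hP0, hQ0, hw0, hα, hκ])
  refine h.congr_deriv ?_
  simp [hP0, hQ0, hw0, hm0]
  field_simp

theorem monRadius_zero : monRadius α 0 0 κ 0 = (sin α * κ)⁻¹ := by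
  simp [monRadius]
  field_simp

end Curve

/-- Derivative of the evolutoid, written in terms of the radius `r` and the first
derivatives `P`, `Q` along a curve through a critical point of the height function. -/
theorem hasDerivAt_evolutoid_curve {α x' y' P' Q' r' : ℝ} {x y z P Q r : ℝ → ℝ}
    (hx : HasDerivAt x x' 0) (hy : HasDerivAt y y' 0) (hz : HasDerivAt z 0 0)
    (hP : HasDerivAt P P' 0) (hP0 : P 0 = 0) (hQ : HasDerivAt Q Q' 0) (hQ0 : Q 0 = 0)
    (hr : HasDerivAt r r' 0) :
    HasDerivAt (fun t =>
      ![x t + r t * (cos α / √(1 + P t ^ 2) +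
          sin α * ((√(1 + P t ^ 2 + Q t ^ 2))⁻¹ * -P t)),
        y t + r t * (sin α * ((√(1 + P t ^ 2 + Q t ^ 2))⁻¹ * -Q t)),
        z t + r t * (cos α / √(1 + P t ^ 2) * P t +
          sin α * (√(1 + P t ^ 2 + Q t ^ 2))⁻¹)])
      ![x' + r' * cos α - r 0 * sin α * P', y' - r 0 * sin α * Q',
        r 0 * cos α * P' + r' * sin α] 0 := by
  have hE := hasDerivAt_sqrt_one_add_sq hP hP0
  have hW := hasDerivAt_inv_sqrt_one_add_sq_add_sq hP hP0 hQ hQ0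
  have hc := (hasDerivAt_const (0 : ℝ) (cos α)).div hE (by simp [hP0])
  refine hasDerivAt_vec3
    ((hx.add (hr.mul (hc.add ((hW.mul hP.neg).const_mul (sin α))))).congr_deriv ?_)
    ((hy.add (hr.mul ((hW.mul hQ.neg).const_mul (sin α)))).congr_deriv ?_)
    ((hz.add (hr.mul ((hc.mul hP).add (hW.const_mul (sin α))))).congr_deriv ?_)
  · simp [hP0, hQ0]
    ring
  · simp [hQ0, hP0]
    ring
  · simp [hP0, hQ0]
    ring

theorem evolutoid_regular_iff_not_ridge
    (α κ₁ κ₂ : ℝ) (a : ℕ → ℕ → ℝ) (f : ℝ × ℝ → ℝ)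
    (hα : α ∈ Set.Ioo 0 (Real.pi / 2))
    (hκ : κ₂ < κ₁) (hκ₁ : κ₁ ≠ 0) (hκ₂ : κ₂ ≠ 0)
    (hf : MongeHyp κ₁ κ₂ a f)
    (hne : Real.sin α ^ 2 * κ₂ ≠ κ₁) :
    cross3 (pdu (evolutoid α f) (0, 0)) (pdv (evolutoid α f) (0, 0)) ≠ (0 : Fin 3 → ℝ) ↔
      a 0 3 ≠ 0 := by
  obtain ⟨hs, -, hfu, hfv, hfuu, hfuv, hfvv, h34⟩ := hf
  have h03 : pdv (pdv (pdv f)) (0, 0) = a 0 3 := h34 0 3 (by simp) (by simp)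
  replace hfuu : pdu (pdu f) (0, 0) = κ₁ := hfuu
  replace hfuv : pdu (pdv f) (0, 0) = 0 := hfuv
  replace hfvv : pdv (pdv f) (0, 0) = κ₂ := hfvv
  have hfvu : pdv (pdu f) (0, 0) = 0 := by rw [pdv_pdu_comm hs, hfuv]
  have hsin : sin α ≠ 0 := (sin_pos_of_pos_of_lt_pi hα.1 (by linarith [hα.2, pi_pos])).ne'
  have hdf := hs.differentiable (by simp)
  have hdu := (contDiff_pdu hs).differentiable (by simp)
  have hdv := (contDiff_pdv hs).differentiable (by simp)
  have hdvv := (contDiff_pdv (contDiff_pdv hs)).differentiable (by simp)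
  have hduv := (contDiff_pdu (contDiff_pdv hs)).differentiable (by simp)
  have hr0 : rfun α f (0, 0) = (sin α * κ₂)⁻¹ := by
    rw [rfun_eq_monRadius α hs, hfu, hfv, hfuv, hfvv, monRadius_zero]
  obtain ⟨b, hb⟩ : ∃ b, pdu (pdv (pdv f)) (0, 0) = b := ⟨_, rfl⟩
  have hru : HasDerivAt (fun t => rfun α f (t, 0))
      (-b / (sin α * κ₂ ^ 2)) 0 := by
    simp only [rfun_eq_monRadius α hs, ← hb]
    exact hasDerivAt_monRadius (hasDerivAt_pdu hdu (0, 0)) hfu (hasDerivAt_pdu hdv (0, 0)) hfv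
      (hasDerivAt_pdu hdvv (0, 0)) hfvv (hasDerivAt_pdu hduv (0, 0)) hfuv hsin hκ₂
  have hrv : HasDerivAt (fun t => rfun α f (0, t)) (-a 0 3 / (sin α * κ₂ ^ 2)) 0 := by
    simp only [rfun_eq_monRadius α hs, ← h03]
    exact hasDerivAt_monRadius (hasDerivAt_pdv hdu (0, 0)) hfu (hasDerivAt_pdv hdv (0, 0)) hfv
      (hasDerivAt_pdv hdvv (0, 0)) hfvv (hasDerivAt_pdv hduv (0, 0)) hfuv hsin hκ₂
  have hev : evolutoid α f = _ := funext (evolutoid_eq α hs)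
  have hu : pdu (evolutoid α f) (0, 0) =
      ![1 - κ₁ / κ₂ - b * cos α / (sin α * κ₂ ^ 2), 0,
        cos α * κ₁ / (sin α * κ₂) - b / κ₂ ^ 2] := by
    rw [hev]
    refine (hasDerivAt_evolutoid_curve (hasDerivAt_id (0 : ℝ))
      (hasDerivAt_const (0 : ℝ) (0 : ℝ)) ((hasDerivAt_pdu hdf (0, 0)).congr_deriv hfu)
      (hasDerivAt_pdu hdu (0, 0)) hfu (hasDerivAt_pdu hdv (0, 0)) hfv hru).deriv.trans ?_
    rw [hr0, hfuu, hfuv]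
    congr! 1
    · field_simp
      ring
    congr! 1
    · ring
    congr! 1
    field_simp
    ring
  have hv : pdv (evolutoid α f) (0, 0) =
      ![-a 0 3 * cos α / (sin α * κ₂ ^ 2), 0, -a 0 3 / κ₂ ^ 2] := by
    rw [hev]
    refine (hasDerivAt_evolutoid_curve (hasDerivAt_const (0 : ℝ) (0 : ℝ))
      (hasDerivAt_id (0 : ℝ)) ((hasDerivAt_pdv hdf (0, 0)).congr_deriv hfv)
      (hasDerivAt_pdv hdu (0, 0)) hfu (hasDerivAt_pdv hdv (0, 0)) hfv hrv).deriv.trans ?_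
    rw [hr0, hfvu, hfvv]
    congr! 1
    · ring
    congr! 1
    · field_simp
      ring
    congr! 1
    field_simp
    ring
  have hcross : cross3 (pdu (evolutoid α f) (0, 0)) (pdv (evolutoid α f) (0, 0)) =
      ![0, a 0 3 * ((sin α ^ 2 * κ₂ - κ₁) / (sin α ^ 2 * κ₂ ^ 3)), 0] := by
    rw [hu, hv]
    simp only [cross3, Matrix.cons_val]
    congr! 1
    · ring
    congr! 1
    · field_simp
      linear_combination (-κ₁ * κ₂ * a 0 3) * sin_sq_add_cos_sq α
    congr! 1
    ring
  rw [hcross, not_iff_not]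
  constructor
  · intro h
    have h1 : a 0 3 * ((sin α ^ 2 * κ₂ - κ₁) / (sin α ^ 2 * κ₂ ^ 3)) = 0 := congrFun h 1
    refine (mul_eq_zero.mp h1).resolve_right (div_ne_zero (sub_ne_zero.mpr hne) ?_)
    positivity
  · intro h
    ext i
    fin_cases i <;> simp [h]
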